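/- Let G be a finite graph (possibly with loops) and I its edge ideal. The following are equivalent: (a) G is gap free; (b) index(I^k) > 1 for all k >= 1; (c) index(I^k) > 1 for some k >= 1. -/

import Mathlib

open MvPolynomial

noncomputable section

abbrev SRing (K : Type) [Field K] (n : ℕ) := MvPolynomial (Fin n) K

/-- total degree of an exponent vector -/
def mdeg {n : ℕ} (e : Fin n →₀ ℕ) : ℕ := e.sum fun _ v => v

/-- minimal monomial generators of a monomial ideal, as exponent vectors:
monomials in `J` none of whose proper divisors lies in `J` -/
def minGen {K : Type} [Field K] {n : ℕ} (J : Ideal (SRing K n)) : Set (Fin n →₀ ℕ) :=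
  {e | (monomial e (1:K)) ∈ J ∧
    ∀ e' : Fin n →₀ ℕ, e' ≤ e → e' ≠ e → (monomial e' (1:K)) ∉ J}

/-- adjacency in the graph `G_J^{(u,v)}` : vertices are the minimal generators of `J`
dividing `lcm(u,v)`, with an edge between two of them iff their lcm has degree `d+1` -/
def lcmGraphAdj {K : Type} [Field K] {n : ℕ} (J : Ideal (SRing K n)) (d : ℕ)
    (u v : Fin n →₀ ℕ) (w w' : Fin n →₀ ℕ) : Prop :=
  w ∈ minGen J ∧ w' ∈ minGen J ∧ w ≤ u ⊔ v ∧ w' ≤ u ⊔ v ∧ mdeg (w ⊔ w') = d + 1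

/-- a graded partial free resolution of the ideal `I`, exact at homological positions `< r`:
`F_i` is free with basis in (internal) degrees `dg i`, the maps are graded of degree `0`,
`F_0` surjects onto `I`, and the sequence is exact at `F_i` for `i < r`. -/
structure GradedPartialRes {K : Type} [Field K] {n : ℕ} (I : Ideal (SRing K n)) (r : ℕ∞) where
  s : ℕ → ℕ
  dg : ∀ i, Fin (s i) → ℕ
  aug : (Fin (s 0) →₀ SRing K n) →ₗ[SRing K n] SRing K n
  diff : ∀ i, (Fin (s (i+1)) →₀ SRing K n) →ₗ[SRing K n] (Fin (s i) →₀ SRing K n)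
  aug_hom : ∀ k, (aug (Finsupp.single k 1)).IsHomogeneous (dg 0 k)
  diff_hom : ∀ i k l, (diff i (Finsupp.single k 1)) l = 0 ∨
      ∃ m, ((diff i (Finsupp.single k 1)) l).IsHomogeneous m ∧ dg i l + m = dg (i+1) k
  aug_range : LinearMap.range aug = I
  exact_zero : (0 : ℕ∞) < r → LinearMap.range (diff 0) = LinearMap.ker aug
  exact_succ : ∀ i : ℕ, ((i : ℕ∞) + 1) < r →
      LinearMap.range (diff (i+1)) = LinearMap.ker (diff i)

/-- the graded Betti number `β_{i,j}(I)`: the minimal number of degree-`j` basis elements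
in homological position `i`, over all graded partial resolutions of `I` exact at
positions `0, …, i` (the minimum is attained by the minimal graded free resolution). -/
def gradedBetti {K : Type} [Field K] {n : ℕ} (I : Ideal (SRing K n)) (i j : ℕ) : ℕ∞ :=
  ⨅ R : GradedPartialRes I ((i : ℕ∞)+1),
    ((Finset.univ.filter fun k => R.dg i k = j).card : ℕ∞)

/-- `I` (generated in degree `d`) is `r` steps linear: `β_{i,i+j}(I) = 0` for
all `i ≤ r` and `j > d` -/
def stepsLinear {K : Type} [Field K] {n : ℕ} (I : Ideal (SRing K n)) (d r : ℕ) : Prop :=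
  ∀ i ≤ r, ∀ j, d < j → gradedBetti I i (i+j) = 0

/-- `index(I) = sup{r : I is r steps linear} + 1` -/
def idealIndex {K : Type} [Field K] {n : ℕ} (I : Ideal (SRing K n)) (d : ℕ) : ℕ∞ :=
  sSup {x : ℕ∞ | ∃ r : ℕ, x = (r : ℕ∞) + 1 ∧ stepsLinear I d r}

/-- `I` is linearly related: all first syzygies are linear, i.e. `index(I) > 1` -/
def LinearlyRelated {K : Type} [Field K] {n : ℕ} (I : Ideal (SRing K n)) (d : ℕ) : Prop :=
  stepsLinear I d 1

/-- projective dimension of `I`: the minimal length of a graded free resolution of `I` -/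
def projDim {K : Type} [Field K] {n : ℕ} (I : Ideal (SRing K n)) : ℕ∞ :=
  sInf {x : ℕ∞ | ∃ m : ℕ, x = (m : ℕ∞) ∧
    ∃ R : GradedPartialRes I ⊤, ∀ i : ℕ, m < i → R.s i = 0}

/-- the edge ideal of the graph (possibly with loops) given by a symmetric relation `E`:
generated by the monomials `X i * X j` with `E i j` -/
def edgeIdeal (K : Type) [Field K] {n : ℕ} (E : Fin n → Fin n → Prop) : Ideal (SRing K n) :=
  Ideal.span {p | ∃ i j, E i j ∧ p = X i * X j}

/-- `E` is gap free: for any two disjoint edges there is an edge meeting both -/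
def GapFree {n : ℕ} (E : Fin n → Fin n → Prop) : Prop :=
  ∀ i i' j j', E i i' → E j j' → i ≠ j → i ≠ j' → i' ≠ j → i' ≠ j' →
    ∃ a b, E a b ∧ (a = i ∨ a = i') ∧ (b = j ∨ b = j')

/-- exponent vectors of products of `k` edges -/
inductive EdgeSum {n : ℕ} (E : Fin n → Fin n → Prop) : ℕ → (Fin n →₀ ℕ) → Prop
  | zero : EdgeSum E 0 0
  | add_edge {k : ℕ} {w : Fin n →₀ ℕ} {i j : Fin n} (hw : EdgeSum E k w) (hij : E i j) :
      EdgeSum E (k + 1) (w + (Finsupp.single i 1 + Finsupp.single j 1))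

/-- `w` and `w'` are products of `k` edges differing in one variable, with lcm dividing `m` -/
def EdgeStep {n : ℕ} (E : Fin n → Fin n → Prop) (k : ℕ) (m w w' : Fin n →₀ ℕ) : Prop :=
  EdgeSum E k w ∧ EdgeSum E k w' ∧
    ∃ p q, w + Finsupp.single p 1 = w' + Finsupp.single q 1 ∧ w + Finsupp.single p 1 ≤ m

section Combinatorics

variable {n : ℕ} {E : Fin n → Fin n → Prop}

theorem EdgeSum.degree_eq {k : ℕ} {w : Fin n →₀ ℕ} (h : EdgeSum E k w) : w.degree = 2 * k := by
  induction h with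
  | zero => simp
  | add_edge hw hij ih => simp only [map_add, ih, Finsupp.degree_single]; ring

theorem EdgeSum.exists_of_pos (hsymm : ∀ i j, E i j → E j i) {k : ℕ} {v : Fin n →₀ ℕ}
    (h : EdgeSum E k v) {p : Fin n} (hp : 0 < v p) :
    ∃ k' p' v', k = k' + 1 ∧ E p p' ∧ EdgeSum E k' v' ∧
      v = v' + (Finsupp.single p 1 + Finsupp.single p' 1) := by
  induction h with
  | zero => simp at hp
  | @add_edge k w i j hw hij ih =>
    by_cases hpi : p = i
    · subst hpi
      exact ⟨k, j, w, rfl, hij, hw, rfl⟩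
    by_cases hpj : p = j
    · subst hpj
      exact ⟨k, i, w, rfl, hsymm _ _ hij, hw, by rw [add_comm (Finsupp.single p 1)]⟩
    have hwp : 0 < w p := by
      simpa [Finsupp.single_apply, Ne.symm hpi, Ne.symm hpj] using hp
    obtain ⟨k', p', v', rfl, hE, hv', rfl⟩ := ih hwp
    exact ⟨k' + 1, p', _, rfl, hE, hv'.add_edge hij, by abel⟩

theorem EdgeStep.symm {k : ℕ} {m w w' : Fin n →₀ ℕ} (h : EdgeStep E k m w w') :
    EdgeStep E k m w' w := by
  obtain ⟨hw, hw', p, q, hpq, hm⟩ := h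
  exact ⟨hw', hw, q, p, hpq.symm, hpq ▸ hm⟩

theorem reflTransGen_edgeStep_symm {k : ℕ} {m u v : Fin n →₀ ℕ}
    (h : Relation.ReflTransGen (EdgeStep E k m) u v) :
    Relation.ReflTransGen (EdgeStep E k m) v u := by
  induction h with
  | refl => exact .refl
  | tail _ hs ih => exact .head hs.symm ih

/-- any two products of `k` edges dividing a monomial are connected below that monomial -/
def EdgeConnected (E : Fin n → Fin n → Prop) (k : ℕ) : Prop :=
  ∀ m u v, EdgeSum E k u → EdgeSum E k v → u ≤ m → v ≤ m →
    Relation.ReflTransGen (EdgeStep E k m) u v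

theorem EdgeConnected.add_edge {k : ℕ} (hk : EdgeConnected E k) {m a b : Fin n →₀ ℕ} {i j : Fin n}
    (hij : E i j) (ha : EdgeSum E k a) (hb : EdgeSum E k b)
    (ham : a + (Finsupp.single i 1 + Finsupp.single j 1) ≤ m)
    (hbm : b + (Finsupp.single i 1 + Finsupp.single j 1) ≤ m) :
    Relation.ReflTransGen (EdgeStep E (k + 1) m)
      (a + (Finsupp.single i 1 + Finsupp.single j 1))
      (b + (Finsupp.single i 1 + Finsupp.single j 1)) := by
  obtain ⟨m, rfl⟩ := exists_add_of_le (le_add_self.trans ham)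
  rw [add_comm _ m] at ham hbm ⊢
  refine (hk m a b ha hb (le_of_add_le_add_right ham) (le_of_add_le_add_right hbm)).lift
    (· + (Finsupp.single i 1 + Finsupp.single j 1)) ?_
  rintro w w' ⟨hw, hw', p, q, hpq, hm⟩
  refine ⟨hw.add_edge hij, hw'.add_edge hij, p, q, ?_, ?_⟩
  · rw [add_right_comm, hpq, add_right_comm]
  · rw [add_right_comm]
    exact add_le_add_left hm _

theorem EdgeConnected.of_apply_lt (hsymm : ∀ i j, E i j → E j i) {k : ℕ} (hk : EdgeConnected E k)
    {m u v : Fin n →₀ ℕ} {p p' : Fin n} (hu : EdgeSum E (k + 1) u) (hv : EdgeSum E k v)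
    (hE : E p p') (hum : u ≤ m) (hvm : v + (Finsupp.single p 1 + Finsupp.single p' 1) ≤ m)
    (hp : u p < (v + (Finsupp.single p 1 + Finsupp.single p' 1) : Fin n →₀ ℕ) p) (hp' : 0 < u p') :
    Relation.ReflTransGen (EdgeStep E (k + 1) m) u
      (v + (Finsupp.single p 1 + Finsupp.single p' 1)) := by
  obtain ⟨k', q, u', hk', hq, hu', rfl⟩ := hu.exists_of_pos hsymm hp'
  obtain rfl : k = k' := by omega
  have hle : u' + (Finsupp.single p' 1 + Finsupp.single q 1) + Finsupp.single p 1 ≤ m := by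
    intro x
    have h1 := hum x
    have h2 := hvm p
    by_cases hx : p = x
    · subst hx
      rw [Finsupp.add_apply, Finsupp.single_eq_same]
      omega
    · rwa [Finsupp.add_apply, Finsupp.single_eq_of_ne' hx, add_zero]
  have heq : u' + (Finsupp.single p' 1 + Finsupp.single q 1) + Finsupp.single p 1 =
      u' + (Finsupp.single p 1 + Finsupp.single p' 1) + Finsupp.single q 1 := by abel
  refine .head ⟨hu, hu'.add_edge hE, p, q, heq, hle⟩ (hk.add_edge hE hu' hv ?_ hvm)
  rw [heq] at hle
  exact le_self_add.trans hle

theorem EdgeConnected.of_joining_edge {k : ℕ}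
    (hk : EdgeConnected E k) {m u v : Fin n →₀ ℕ} {p p' q q' : Fin n}
    (hu : EdgeSum E k u) (hv : EdgeSum E k v) (hp : E p p') (hq : E q q') (hpq : E p q)
    (hum : u + (Finsupp.single q 1 + Finsupp.single q' 1) ≤ m)
    (hvm : v + (Finsupp.single p 1 + Finsupp.single p' 1) ≤ m)
    (hup : (u + (Finsupp.single q 1 + Finsupp.single q' 1) : Fin n →₀ ℕ) p = 0)
    (hup' : (u + (Finsupp.single q 1 + Finsupp.single q' 1) : Fin n →₀ ℕ) p' = 0) :
    Relation.ReflTransGen (EdgeStep E (k + 1) m)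
      (u + (Finsupp.single q 1 + Finsupp.single q' 1))
      (v + (Finsupp.single p 1 + Finsupp.single p' 1)) := by
  have hle : u + (Finsupp.single p 1 + Finsupp.single p' 1) + Finsupp.single q 1 ≤ m := by
    intro x
    have h1 := hum x
    have h2 := hvm x
    by_cases hx : p = x <;> by_cases hx' : p' = x <;> by_cases hxq : q = x <;>
      (try subst hx) <;> (try subst hx') <;> (try subst hxq) <;>
      simp_all [Finsupp.single_apply] <;> omega
  have hle' : u + (Finsupp.single q 1 + Finsupp.single q' 1) + Finsupp.single p 1 ≤ m := by
    intro x
    have h1 := hum x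
    have h2 := hvm p
    by_cases hx : p = x
    · subst hx
      rw [Finsupp.add_apply, hup, Finsupp.single_eq_same]
      simp only [Finsupp.add_apply, Finsupp.single_eq_same] at h2
      omega
    · rwa [Finsupp.add_apply, Finsupp.single_eq_of_ne' hx, add_zero]
  refine .head ⟨hu.add_edge hq, hu.add_edge hpq, p, q', by abel, hle'⟩
    (.head ⟨hu.add_edge hpq, hu.add_edge hp, p', q, by abel, ?_⟩ (hk.add_edge hp hu hv ?_ hvm))
  · convert hle using 1
    abel
  · exact le_self_add.trans hle

theorem edgeConnected_of_gapFree (hsymm : ∀ i j, E i j → E j i) (hE : GapFree E) (k : ℕ) :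
    EdgeConnected E k := by
  induction k with
  | zero =>
    intro m u v hu hv _ _
    cases hu
    cases hv
    exact .refl
  | succ k hk =>
    intro m u v hu hv hum hvm
    have hdeg : ∀ {u v : Fin n →₀ ℕ}, EdgeSum E (k + 1) u → EdgeSum E (k + 1) v → u ≠ v →
        ∃ p, u p < v p := by
      intro u v hu hv hne
      by_contra! hle
      obtain ⟨c, rfl⟩ := exists_add_of_le (show v ≤ u from hle)
      have h := hu.degree_eq
      rw [map_add, hv.degree_eq] at h
      have hc : c.degree = 0 := by omega
      rw [Finsupp.degree_eq_zero_iff] at hc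
      exact hne (by rw [hc, add_zero])
    by_cases hne : u = v
    · subst hne
      exact .refl
    obtain ⟨p, hp⟩ := hdeg hu hv hne
    obtain ⟨q, hq⟩ := hdeg hv hu (Ne.symm hne)
    obtain ⟨k₁, p', v', hk₁, hpE, hv', hveq⟩ := hv.exists_of_pos hsymm (Nat.zero_lt_of_lt hp)
    obtain ⟨k₂, q', u', hk₂, hqE, hu', hueq⟩ := hu.exists_of_pos hsymm (Nat.zero_lt_of_lt hq)
    obtain rfl : k = k₁ := by omega
    obtain rfl : k = k₂ := by omega
    have hveq' : v = v' + (Finsupp.single p' 1 + Finsupp.single p 1) := by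
      rw [hveq, add_comm (Finsupp.single p 1)]
    have hueq' : u = u' + (Finsupp.single q' 1 + Finsupp.single q 1) := by
      rw [hueq, add_comm (Finsupp.single q 1)]
    have hvp' : 0 < v p' := by simp [hveq']
    have huq' : 0 < u q' := by simp [hueq']
    by_cases h1 : 0 < u p'
    · rw [hveq] at hp hvm ⊢
      exact hk.of_apply_lt hsymm hu hv' hpE hum hvm hp h1
    by_cases h2 : 0 < u p
    · rw [hveq'] at hvp' hvm ⊢
      exact hk.of_apply_lt hsymm hu hv' (hsymm _ _ hpE) hum hvm (by omega) h2
    by_cases h3 : 0 < v q'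
    · rw [hueq] at hq hum ⊢
      exact reflTransGen_edgeStep_symm (hk.of_apply_lt hsymm hv hu' hqE hvm hum hq h3)
    by_cases h4 : 0 < v q
    · rw [hueq'] at huq' hum ⊢
      exact reflTransGen_edgeStep_symm
        (hk.of_apply_lt hsymm hv hu' (hsymm _ _ hqE) hvm hum (by omega) h4)
    have hne' : ∀ {a b : Fin n}, ¬ 0 < u a → 0 < u b → a ≠ b := by
      rintro a _ ha hb rfl
      exact ha hb
    have hq0 : 0 < u q := by omega
    obtain ⟨a, b, hab, ha, hb⟩ := hE p p' q q' hpE hqE (hne' h2 hq0) (hne' h2 huq')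
      (hne' h1 hq0) (hne' h1 huq')
    have key : ∀ {p p' q q' : Fin n}, E p p' → E q q' → E p q →
        v = v' + (Finsupp.single p 1 + Finsupp.single p' 1) →
        u = u' + (Finsupp.single q 1 + Finsupp.single q' 1) → ¬ 0 < u p → ¬ 0 < u p' →
        Relation.ReflTransGen (EdgeStep E (k + 1) m) u v := by
      intro p p' q q' hpE hqE hpq hv hu h2 h1
      subst hv hu
      exact hk.of_joining_edge hu' hv' hpE hqE hpq hum hvm (by omega) (by omega)
    rcases ha with rfl | rfl <;> rcases hb with rfl | rfl
    · exact key hpE hqE hab hveq hueq h2 h1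
    · exact key hpE (hsymm _ _ hqE) hab hveq hueq' h2 h1
    · exact key (hsymm _ _ hpE) hqE hab hveq' hueq h1 h2
    · exact key (hsymm _ _ hpE) (hsymm _ _ hqE) hab hveq' hueq' h1 h2

end Combinatorics

section HomogeneousKernel

variable {K : Type} [Field K] {n : ℕ}

theorem homogeneousComponent_mul_of_isHomogeneous (p : SRing K n) {h : SRing K n} {e : ℕ}
    (hh : h.IsHomogeneous e) (t : ℕ) :
    homogeneousComponent (t + e) (p * h) = homogeneousComponent t p * h := by
  conv_lhs => rw [← sum_homogeneousComponent p, Finset.sum_mul, map_sum]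
  have hterm : ∀ i, homogeneousComponent (t + e) (homogeneousComponent i p * h) =
      if i = t then homogeneousComponent t p * h else 0 := by
    intro i
    rw [homogeneousComponent_of_mem ((homogeneousComponent_isHomogeneous i p).mul hh)]
    by_cases hi : i = t
    · simp [hi]
    · simp [hi, Ne.symm hi]
  rw [Finset.sum_congr rfl fun i _ => hterm i, Finset.sum_ite_eq']
  split_ifs with ht
  · rfl
  · rw [homogeneousComponent_eq_zero _ _ (by simpa using ht), zero_mul]

theorem mapRange_homogeneousComponent_map {a b : ℕ}
    (f : (Fin b →₀ SRing K n) →ₗ[SRing K n] (Fin a →₀ SRing K n)) {e : ℕ}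
    (hf : ∀ k l, (f (Finsupp.single k 1) l).IsHomogeneous e) (t : ℕ) (y : Fin b →₀ SRing K n) :
    f (Finsupp.mapRange.linearMap (homogeneousComponent t) y) =
      Finsupp.mapRange.linearMap (homogeneousComponent (t + e)) (f y) := by
  induction y using Finsupp.induction_linear with
  | zero => simp
  | add y z hy hz => simp only [map_add, hy, hz]
  | single k p =>
    have hs : ∀ q : SRing K n, Finsupp.single k q = q • Finsupp.single k (1 : SRing K n) := by
      simp
    rw [Finsupp.mapRange.linearMap_apply, Finsupp.mapRange_single, hs, hs p, map_smul, map_smul]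
    ext1 l
    simp [homogeneousComponent_mul_of_isHomogeneous p (hf k l)]

theorem exists_homogeneous_generators_ker {a b : ℕ}
    (f : (Fin b →₀ SRing K n) →ₗ[SRing K n] (Fin a →₀ SRing K n)) {e : ℕ}
    (hf : ∀ k l, (f (Finsupp.single k 1) l).IsHomogeneous e) :
    ∃ (c : ℕ) (t : Fin c → ℕ) (g : (Fin c →₀ SRing K n) →ₗ[SRing K n] (Fin b →₀ SRing K n)),
      LinearMap.range g = LinearMap.ker f ∧
      ∀ k l, (g (Finsupp.single k 1) l).IsHomogeneous (t k) := by
  set H : Set (Fin b →₀ SRing K n) := {y | f y = 0 ∧ ∃ t, ∀ l, (y l).IsHomogeneous t} with hH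
  have hspan : Submodule.span (SRing K n) H = LinearMap.ker f := by
    refine le_antisymm (Submodule.span_le.2 fun y hy => hy.1) fun y hy => ?_
    rw [LinearMap.mem_ker] at hy
    set B := (Finset.univ.sup fun l => (y l).totalDegree) + 1
    have hsum : y = ∑ t ∈ Finset.range B,
        Finsupp.mapRange.linearMap (homogeneousComponent (R := K) t) y := by
      ext1 l
      rw [Finsupp.finsetSum_apply]
      simp only [Finsupp.mapRange.linearMap_apply, Finsupp.mapRange_apply]
      conv_lhs => rw [← sum_homogeneousComponent (y l)]
      refine Finset.sum_subset ?_ fun t _ ht => homogeneousComponent_eq_zero _ _ (by simpa using ht)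
      refine Finset.range_mono (Nat.add_le_add_right ?_ 1)
      exact Finset.le_sup (f := fun l => (y l).totalDegree) (Finset.mem_univ l)
    rw [hsum]
    refine Submodule.sum_mem _ fun t _ => Submodule.subset_span ⟨?_, t, fun l => ?_⟩
    · rw [mapRange_homogeneousComponent_map f hf, hy, map_zero]
    · simpa using homogeneousComponent_isHomogeneous t (y l)
  obtain ⟨s, hsH, hs⟩ := (Submodule.fg_span_iff_fg_span_finset_subset H).1
    (IsNoetherian.noetherian (Submodule.span (SRing K n) H))
  have hmem : ∀ k, ((s.equivFin.symm k : s) : Fin b →₀ SRing K n) ∈ H :=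
    fun k => hsH (s.equivFin.symm k).2
  choose t ht using fun k => (hmem k).2
  refine ⟨s.card, t, Finsupp.linearCombination _ fun k => (s.equivFin.symm k).1, ?_, ?_⟩
  · rw [Finsupp.range_linearCombination, ← hspan, hs]
    congr 1
    ext y
    constructor
    · rintro ⟨k, rfl⟩
      exact (s.equivFin.symm k).2
    · intro hy
      exact ⟨s.equivFin ⟨y, hy⟩, by simp⟩
  · intro k l
    simpa using ht k l

end HomogeneousKernel

section MonomialIdeal

variable {K : Type} [Field K] {n N : ℕ}

/-- the map sending the basis vectors to the monomials with exponents `g` -/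
def monomialMap (K : Type) [Field K] {n N : ℕ} (g : Fin N → Fin n →₀ ℕ) :
    (Fin N →₀ SRing K n) →ₗ[SRing K n] SRing K n :=
  Finsupp.linearCombination _ fun a => monomial (g a) 1

theorem monomialMap_single (g : Fin N → Fin n →₀ ℕ) (a : Fin N) (p : SRing K n) :
    monomialMap K g (Finsupp.single a p) = p * monomial (g a) 1 := by
  simp [monomialMap]

theorem range_monomialMap (g : Fin N → Fin n →₀ ℕ) :
    LinearMap.range (monomialMap K g) =
      Ideal.span ((fun e => monomial e (1 : K)) '' Set.range g) := by
  rw [monomialMap, Finsupp.range_linearCombination, ← Set.range_comp]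
  rfl

theorem ker_monomialMap_le (g : Fin N → Fin n →₀ ℕ)
    (L : Submodule (SRing K n) (Fin N →₀ SRing K n))
    (hL : ∀ m a b, g a ≤ m → g b ≤ m → Finsupp.single a (monomial (m - g a) (1 : K)) -
      Finsupp.single b (monomial (m - g b) 1) ∈ L) :
    LinearMap.ker (monomialMap K g) ≤ L := by
  classical
  let θ : (Fin n →₀ ℕ) → (Fin N →₀ SRing K n) ⧸ L := fun m =>
    if h : ∃ a, g a ≤ m then L.mkQ (Finsupp.single h.choose (monomial (m - g h.choose) 1)) else 0
  let Θ : SRing K n →ₗ[K] (Fin N →₀ SRing K n) ⧸ L := (basisMonomials (Fin n) K).constr K θ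
  have hΘ : ∀ m (r : K), Θ (monomial m r) = r • θ m := by
    intro m r
    have h := (basisMonomials (Fin n) K).constr_basis K θ m
    rw [coe_basisMonomials] at h
    rw [← mul_one r, ← smul_eq_mul, ← smul_monomial, map_smul, smul_eq_mul, mul_one]
    exact congrArg _ h
  have key : ∀ z, Θ (monomialMap K g z) = L.mkQ z := by
    intro z
    induction z using Finsupp.induction_linear with
    | zero => simp
    | add y z hy hz => simp only [map_add, hy, hz]
    | single a p =>
      induction p using MvPolynomial.induction_on' with
      | add p q hp hq => rw [Finsupp.single_add, map_add, map_add, map_add, hp, hq]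
      | monomial c r =>
        rw [monomialMap_single, monomial_mul, mul_one, hΘ]
        have hex : ∃ b, g b ≤ c + g a := ⟨a, le_add_self⟩
        have hθ : θ (c + g a) = L.mkQ (Finsupp.single a (monomial c 1)) := by
          simp only [θ, dif_pos hex]
          rw [← sub_eq_zero, ← map_sub, Submodule.mkQ_apply, Submodule.Quotient.mk_eq_zero]
          convert hL (c + g a) hex.choose a hex.choose_spec le_add_self using 3
          rw [add_tsub_cancel_right]
        rw [hθ, Submodule.mkQ_apply, Submodule.mkQ_apply, ← Submodule.Quotient.mk_smul,
          Finsupp.smul_single, smul_monomial, smul_eq_mul, mul_one]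
  intro z hz
  rw [LinearMap.mem_ker] at hz
  have h := key z
  rw [hz, map_zero, Submodule.mkQ_apply] at h
  exact (Submodule.Quotient.mk_eq_zero L).1 h.symm

/-- the resolution with zero modules in positions above `2` -/
def GradedPartialRes.ofPresentation {I : Ideal (SRing K n)} {a b c d e : ℕ} (t : Fin c → ℕ)
    (f₀ : (Fin a →₀ SRing K n) →ₗ[SRing K n] SRing K n)
    (f₁ : (Fin b →₀ SRing K n) →ₗ[SRing K n] (Fin a →₀ SRing K n))
    (f₂ : (Fin c →₀ SRing K n) →ₗ[SRing K n] (Fin b →₀ SRing K n))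
    (h₀ : ∀ k, (f₀ (Finsupp.single k 1)).IsHomogeneous d)
    (h₁ : ∀ k l, (f₁ (Finsupp.single k 1) l).IsHomogeneous e)
    (h₂ : ∀ k l, (f₂ (Finsupp.single k 1) l).IsHomogeneous (t k))
    (hI : LinearMap.range f₀ = I) (hf₁ : LinearMap.range f₁ = LinearMap.ker f₀)
    (hf₂ : LinearMap.range f₂ = LinearMap.ker f₁) (r : ℕ∞) (hr : r ≤ 2) :
    GradedPartialRes I r where
  s
    | 0 => a
    | 1 => b
    | 2 => c
    | _ => 0
  dg
    | 0 => fun _ => d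
    | 1 => fun _ => d + e
    | 2 => fun k => d + e + t k
    | _ => fun _ => 0
  aug := f₀
  diff
    | 0 => f₁
    | 1 => f₂
    | _ + 2 => 0
  aug_hom := h₀
  diff_hom
    | 0 => fun k l => Or.inr ⟨e, h₁ k l, rfl⟩
    | 1 => fun k l => Or.inr ⟨t k, h₂ k l, rfl⟩
    | _ + 2 => fun _ _ => Or.inl rfl
  aug_range := hI
  exact_zero _ := hf₁
  exact_succ
    | 0 => fun _ => hf₂
    | i + 1 => fun h => by
      have h2 := h.trans_le hr
      norm_cast at h2

theorem gradedBetti_eq_zero_iff {I : Ideal (SRing K n)} {i j : ℕ} :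
    gradedBetti I i j = 0 ↔ ∃ R : GradedPartialRes I ((i : ℕ∞) + 1), ∀ k, R.dg i k ≠ j := by
  rw [gradedBetti, ENat.iInf_eq_zero]
  simp [Finset.filter_eq_empty_iff]

theorem one_lt_idealIndex_iff {I : Ideal (SRing K n)} {d : ℕ} :
    1 < idealIndex I d ↔ stepsLinear I d 1 := by
  rw [idealIndex, lt_sSup_iff]
  constructor
  · rintro ⟨_, ⟨r, rfl, hr⟩, h⟩ i hi
    norm_cast at h
    exact hr i (by omega)
  · exact fun h => ⟨_, ⟨1, rfl, h⟩, by norm_num⟩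

end MonomialIdeal

section LinearRelations

variable {K : Type} [Field K] {n N d : ℕ}

theorem stepsLinear_of_connected (g : Fin N → Fin n →₀ ℕ) (hg : ∀ a, (g a).degree = d)
    (hconn : ∀ m a b, g a ≤ m → g b ≤ m → Relation.ReflTransGen (fun a b => ∃ p q,
      g a + Finsupp.single p 1 = g b + Finsupp.single q 1 ∧ g a + Finsupp.single p 1 ≤ m) a b) :
    stepsLinear (LinearMap.range (monomialMap K g)) d 1 := by
  let ι := {x : (Fin N × Fin N) × (Fin n × Fin n) //
    g x.1.1 + Finsupp.single x.2.1 1 = g x.1.2 + Finsupp.single x.2.2 1}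
  have : Finite ι := inferInstance
  obtain ⟨b, ⟨σ⟩⟩ := Finite.exists_equiv_fin ι
  let rel : (Fin N × Fin N) × (Fin n × Fin n) → (Fin N →₀ SRing K n) := fun x =>
    Finsupp.single x.1.1 (X x.2.1) - Finsupp.single x.1.2 (X x.2.2)
  let f₁ : (Fin b →₀ SRing K n) →ₗ[SRing K n] (Fin N →₀ SRing K n) :=
    Finsupp.linearCombination _ fun k => rel (σ.symm k).1
  have hf₁ : ∀ k, f₁ (Finsupp.single k 1) = rel (σ.symm k).1 := by simp [f₁]
  have h₁ : ∀ k l, (f₁ (Finsupp.single k 1) l).IsHomogeneous 1 := by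
    intro k l
    rw [hf₁]
    simp only [rel, Finsupp.sub_apply, Finsupp.single_apply]
    refine IsHomogeneous.sub ?_ ?_ <;> split_ifs <;>
      first | exact isHomogeneous_X _ _ | exact isHomogeneous_zero _ _ _
  have hmem : ∀ x : ι, rel x.1 ∈ LinearMap.range f₁ := fun x =>
    ⟨Finsupp.single (σ x) 1, by rw [hf₁, Equiv.symm_apply_apply]⟩
  have hexact : LinearMap.range f₁ = LinearMap.ker (monomialMap K g) := by
    apply le_antisymm
    · rw [Finsupp.range_linearCombination, Submodule.span_le]
      rintro _ ⟨k, rfl⟩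
      have hk := (σ.symm k).2
      rw [SetLike.mem_coe, LinearMap.mem_ker]
      simp only [rel, map_sub, monomialMap_single, X, monomial_mul, mul_one]
      rw [add_comm, hk, add_comm, sub_self]
    · refine ker_monomialMap_le g _ fun m a b ha hb => ?_
      induction hconn m a b ha hb with
      | refl => simp
      | @tail b c _ hbc ih =>
        obtain ⟨p, q, hpq, hle⟩ := hbc
        have hb' : g b ≤ m := le_self_add.trans hle
        obtain ⟨s, rfl⟩ := exists_add_of_le hle
        have h := Submodule.add_mem _ (ih hb') (Submodule.smul_mem _ (monomial s (1 : K))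
          (hmem ⟨((b, c), (p, q)), hpq⟩))
        convert h using 1
        have e1 : g b + Finsupp.single p 1 + s - g b = s + Finsupp.single p 1 := by
          rw [add_assoc, add_tsub_cancel_left, add_comm]
        have e2 : g b + Finsupp.single p 1 + s - g c = s + Finsupp.single q 1 := by
          rw [hpq, add_assoc, add_tsub_cancel_left, add_comm]
        simp only [rel, smul_sub, Finsupp.smul_single, smul_eq_mul, X, monomial_mul, mul_one,
          e1, e2]
        abel
  obtain ⟨c, t, f₂, hf₂, h₂⟩ := exists_homogeneous_generators_ker f₁ h₁
  have h₀ : ∀ k, (monomialMap K g (Finsupp.single k 1)).IsHomogeneous d := by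
    intro k
    rw [monomialMap_single, one_mul]
    exact isHomogeneous_monomial _ (hg k)
  intro i hi j hj
  rw [gradedBetti_eq_zero_iff]
  refine ⟨GradedPartialRes.ofPresentation t _ f₁ f₂ h₀ h₁ h₂ rfl hexact hf₂ _ ?_, ?_⟩
  · norm_cast
    omega
  · interval_cases i
    · exact fun _ => by simp only [GradedPartialRes.ofPresentation]; omega
    · exact fun _ => by simp only [GradedPartialRes.ofPresentation]; omega

theorem coeff_linearCombination_monomial (g : Fin N → Fin n →₀ ℕ) (v : Fin N → K)
    (z : Fin N →₀ SRing K n) (m : Fin n →₀ ℕ) :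
    coeff m (Finsupp.linearCombination (SRing K n) (fun a => monomial (g a) (v a)) z) =
      ∑ a, if g a ≤ m then coeff (m - g a) (z a) * v a else 0 := by
  rw [Finsupp.linearCombination_apply, Finsupp.sum_fintype _ _ (by simp), coeff_sum]
  exact Finset.sum_congr rfl fun a _ => coeff_mul_monomial' m (g a) (v a) (z a)

theorem coeff_mul_eq_zero_of_forall_lt {p h : SRing K n} {m : Fin n →₀ ℕ}
    (hlt : ∀ m' < m, coeff m' h = 0) (hm : coeff 0 p = 0 ∨ coeff m h = 0) :
    coeff m (p * h) = 0 := by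
  rw [coeff_mul]
  refine Finset.sum_eq_zero fun x hx => ?_
  rw [Finset.HasAntidiagonal.mem_antidiagonal] at hx
  by_cases hxm : x.2 = m
  · have hx1 : x.1 = 0 := by
      rw [hxm] at hx
      exact add_eq_right.1 hx
    rw [hx1, hxm]
    rcases hm with h | h <;> simp [h]
  · rw [hlt x.2 (lt_of_le_of_ne (hx ▸ le_add_self) hxm), mul_zero]

theorem exists_lift_isHomogeneous (g : Fin N → Fin n →₀ ℕ) (v : Fin N → K) {p : SRing K n} {D : ℕ}
    (hp : p.IsHomogeneous D) (hI : p ∈ LinearMap.range (monomialMap K g)) :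
    ∃ y, monomialMap K g y = p ∧ (Finsupp.linearCombination (SRing K n)
      (fun a => monomial (g a) (v a)) y).IsHomogeneous D := by
  rw [range_monomialMap, mem_ideal_span_monomial_image] at hI
  have hex : ∀ m : p.support, ∃ a, g a ≤ m.1 := fun m => by
    obtain ⟨_, ⟨a, rfl⟩, ha⟩ := hI m.1 m.2
    exact ⟨a, ha⟩
  choose a ha using hex
  refine ⟨∑ m : p.support, Finsupp.single (a m) (monomial (m.1 - g (a m)) (coeff m.1 p)), ?_, ?_⟩
  · simp only [map_sum, monomialMap_single, monomial_mul, mul_one, tsub_add_cancel_of_le (ha _)]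
    conv_rhs => rw [p.as_sum]
    exact Finset.sum_coe_sort p.support fun m => monomial m (coeff m p)
  · rw [map_sum]
    refine IsHomogeneous.sum _ _ _ fun m _ => ?_
    rw [Finsupp.linearCombination_single, smul_eq_mul, monomial_mul, tsub_add_cancel_of_le (ha _)]
    refine isHomogeneous_monomial _ ?_
    by_contra h
    exact mem_support_iff.1 m.2 (hp.coeff_eq_zero h)

/-- For an ideal with linear first syzygies, a set of monomial generators closed under passing
through lcms of degree at most `d + 1` is closed under passing through all lcms. -/
theorem stepsLinear.closed_of_closed_linear {g : Fin N → Fin n →₀ ℕ} (hginj : g.Injective)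
    (hg : ∀ a, (g a).degree = d) (hlin : stepsLinear (LinearMap.range (monomialMap K g)) d 1)
    (χ : Fin N → Prop) (M : Set (Fin n →₀ ℕ)) (hM : IsLowerSet M)
    (hbase : ∀ m ∈ M, m.degree ≤ d + 1 → ∀ a b, g a ≤ m → g b ≤ m → χ a → χ b) :
    ∀ m ∈ M, ∀ a b, g a ≤ m → g b ≤ m → χ a → χ b := by
  classical
  let φ : (Fin N →₀ SRing K n) →ₗ[SRing K n] SRing K n :=
    Finsupp.linearCombination _ fun a => monomial (g a) (if χ a then (1 : K) else 0)
  have hcoeff : ∀ z m, coeff m (monomialMap K g z) =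
      ∑ a, if g a ≤ m then coeff (m - g a) (z a) * 1 else 0 :=
    fun z m => coeff_linearCombination_monomial g (fun _ => 1) z m
  have hcoeffφ : ∀ z m, coeff m (φ z) = ∑ a, if g a ≤ m then
      coeff (m - g a) (z a) * (if χ a then 1 else 0) else 0 :=
    fun z m => coeff_linearCombination_monomial g _ z m
  have hconst : ∀ z, monomialMap K g z = 0 → ∀ a, coeff 0 (z a) = 0 := by
    intro z hz a
    have h := hcoeff z (g a)
    rw [hz, coeff_zero, Finset.sum_eq_single a] at h
    · simpa using h.symm
    · intro b _ hba
      refine if_neg fun hle => hba (hginj ?_)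
      obtain ⟨c, hc⟩ := exists_add_of_le hle
      have hdeg := congrArg Finsupp.degree hc
      rw [map_add, hg, hg] at hdeg
      have hc0 : c.degree = 0 := by omega
      rw [Finsupp.degree_eq_zero_iff] at hc0
      rw [hc, hc0, add_zero]
    · simp
  have key : ∀ m ∈ M, ∀ z, monomialMap K g z = 0 → coeff m (φ z) = 0 := by
    intro m
    induction m using WellFoundedLT.induction with
    | ind m ih =>
    intro hm z hz
    have ih' : ∀ z, monomialMap K g z = 0 → ∀ m' < m, coeff m' (φ z) = 0 :=
      fun z hz m' hm' => ih m' hm' (hM hm'.le hm) z hz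
    by_cases hdeg : m.degree ≤ d + 1
    · by_cases hex : ∃ a, g a ≤ m ∧ χ a
      · obtain ⟨a, ha, hχ⟩ := hex
        rw [← coeff_zero (R := K) m, ← hz, hcoeff, hcoeffφ]
        refine Finset.sum_congr rfl fun b _ => ?_
        split_ifs with hb hχb
        · rfl
        · exact absurd (hbase m hm hdeg a b ha hb hχ) hχb
        · rfl
      · push Not at hex
        rw [hcoeffφ]
        refine Finset.sum_eq_zero fun a _ => ?_
        split_ifs with ha hχ
        · exact absurd hχ (hex a ha)
        · rw [mul_zero]
        · rfl
    · obtain ⟨R, hR⟩ := gradedBetti_eq_zero_iff.1 (hlin 1 le_rfl (m.degree - 1) (by omega))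
      have hy : ∀ l, ∃ y, monomialMap K g y = R.aug (Finsupp.single l 1) ∧
          (φ y).IsHomogeneous (R.dg 0 l) := fun l =>
        exists_lift_isHomogeneous g _ (R.aug_hom l) (R.aug_range.le (LinearMap.mem_range_self _ _))
      choose y hy hyφ using hy
      have hx : ∀ a, ∃ x, R.aug x = monomialMap K g (Finsupp.single a 1) := fun a =>
        LinearMap.mem_range.1 (by rw [R.aug_range]; exact LinearMap.mem_range_self _ _)
      choose x hx using hx
      let β := Finsupp.linearCombination (SRing K n) y
      let α := Finsupp.linearCombination (SRing K n) x
      have hβ : ∀ w, monomialMap K g (β w) = R.aug w := by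
        intro w
        refine LinearMap.congr_fun (f := monomialMap K g ∘ₗ β) (Finsupp.lhom_ext' fun l => ?_) w
        ext1
        simp [β, hy]
      have hα : ∀ w, R.aug (α w) = monomialMap K g w := by
        intro w
        refine LinearMap.congr_fun (f := R.aug ∘ₗ α) (Finsupp.lhom_ext' fun l => ?_) w
        ext1
        simp [α, hx]
      have hβα : coeff m (φ (β (α z) - z)) = 0 := by
        have hsum : φ (β (α z) - z) = ∑ a, z a * φ (β (α (Finsupp.single a 1)) -
            Finsupp.single a 1) := by
          have hz' : z = ∑ a, z a • Finsupp.single a (1 : SRing K n) := by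
            simp [Finsupp.univ_sum_single]
          conv_lhs => rw [hz']
          simp only [map_sum, map_smul, ← Finset.sum_sub_distrib, ← smul_sub, smul_eq_mul]
        rw [hsum, coeff_sum]
        refine Finset.sum_eq_zero fun a _ => coeff_mul_eq_zero_of_forall_lt (ih' _ ?_)
          (Or.inl (hconst z hz a))
        rw [map_sub, hβ, hα, sub_self]
      have hdiff : ∀ c, coeff m (φ (β (R.diff 0 c))) = 0 := by
        intro c
        induction c using Finsupp.induction_linear with
        | zero => simp
        | add c c' hc hc' => simp only [map_add, coeff_add, hc, hc', add_zero]
        | single l p =>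
          have hs : Finsupp.single l p = p • Finsupp.single l (1 : SRing K n) := by simp
          rw [hs, map_smul, map_smul, map_smul, smul_eq_mul]
          refine coeff_mul_eq_zero_of_forall_lt (ih' _ ?_) (Or.inr ?_)
          · rw [hβ, ← LinearMap.mem_ker, ← R.exact_zero (by simp)]
            exact LinearMap.mem_range_self _ _
          · have hhom : (φ (β (R.diff 0 (Finsupp.single l 1)))).IsHomogeneous (R.dg 1 l) := by
              have hβ' : ∀ w, β w = ∑ r, w r • y r := fun w => by
                rw [Finsupp.linearCombination_apply, Finsupp.sum_fintype _ _ (by simp)]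
              rw [hβ', map_sum]
              refine IsHomogeneous.sum _ _ _ fun r _ => ?_
              rw [map_smul, smul_eq_mul]
              rcases R.diff_hom 0 l r with h | ⟨e, he, hdg⟩
              · rw [h, zero_mul]
                exact isHomogeneous_zero _ _ _
              · rw [← hdg, add_comm (R.dg 0 r)]
                exact he.mul (hyφ r)
            refine hhom.coeff_eq_zero fun h => hR l ?_
            omega
      obtain ⟨c, hc⟩ : α z ∈ LinearMap.range (R.diff 0) := by
        rw [R.exact_zero (by simp), LinearMap.mem_ker, hα, hz]
      rwa [← hc, map_sub, coeff_sub, hdiff, zero_sub, neg_eq_zero] at hβα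
  intro m hm a b ha hb hχ
  by_contra hχb
  have h := key m hm
    (Finsupp.single a (monomial (m - g a) 1) - Finsupp.single b (monomial (m - g b) 1)) (by
      simp [map_sub, monomialMap_single, monomial_mul, tsub_add_cancel_of_le ha,
        tsub_add_cancel_of_le hb])
  simp [φ, hχ, hχb, monomial_mul, tsub_add_cancel_of_le ha] at h

end LinearRelations

section EdgeIdeal

variable {n : ℕ} {E : Fin n → Fin n → Prop}

theorem edgeIdeal_pow_eq_span (K : Type) [Field K] (E : Fin n → Fin n → Prop) (k : ℕ) :
    edgeIdeal K E ^ k = Ideal.span ((fun e => monomial e (1 : K)) '' {w | EdgeSum E k w}) := by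
  induction k with
  | zero =>
    rw [pow_zero, eq_comm, Ideal.one_eq_top, Ideal.eq_top_iff_one]
    exact Ideal.subset_span ⟨0, .zero, rfl⟩
  | succ k ih =>
    rw [pow_succ, ih, edgeIdeal, Ideal.span_mul_span']
    congr 1
    ext p
    simp only [Set.mem_mul, Set.mem_image, Set.mem_ofPred_eq]
    constructor
    · rintro ⟨_, ⟨w, hw, rfl⟩, _, ⟨i, j, hij, rfl⟩, rfl⟩
      exact ⟨_, hw.add_edge hij, by simp [X, monomial_mul]⟩
    · rintro ⟨_, h, rfl⟩
      cases h with
      | @add_edge _ w i j hw hij =>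
        exact ⟨_, ⟨w, hw, rfl⟩, _, ⟨i, j, hij, rfl⟩, by simp [X, monomial_mul]⟩

theorem exists_enumeration_edgeSum (E : Fin n → Fin n → Prop) (k : ℕ) :
    ∃ (N : ℕ) (g : Fin N → Fin n →₀ ℕ), g.Injective ∧ Set.range g = {w | EdgeSum E k w} := by
  have hfin : {w : Fin n →₀ ℕ | EdgeSum E k w}.Finite :=
    (Finsupp.finite_of_degree_eq (2 * k)).subset fun w hw => hw.degree_eq
  have := hfin.to_subtype
  obtain ⟨N, ⟨σ⟩⟩ := Finite.exists_equiv_fin {w : Fin n →₀ ℕ | EdgeSum E k w}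
  refine ⟨N, Subtype.val ∘ σ.symm, Subtype.val_injective.comp σ.symm.injective, ?_⟩
  rw [Set.range_comp, σ.symm.range_eq_univ, Set.image_univ, Subtype.range_coe]

theorem edgeSum_nsmul {i j : Fin n} (hij : E i j) (k : ℕ) :
    EdgeSum E k (k • (Finsupp.single i 1 + Finsupp.single j 1)) := by
  induction k with
  | zero => simpa using EdgeSum.zero
  | succ k ih =>
    rw [succ_nsmul]
    exact ih.add_edge hij

theorem stepsLinear_edgeIdeal_pow (K : Type) [Field K] (hsymm : ∀ i j, E i j → E j i)
    (hE : GapFree E) (k : ℕ) : stepsLinear (edgeIdeal K E ^ k) (2 * k) 1 := by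
  obtain ⟨N, g, hginj, hgr⟩ := exists_enumeration_edgeSum E k
  have hmem : ∀ a, EdgeSum E k (g a) := fun a => hgr.subset ⟨a, rfl⟩
  rw [edgeIdeal_pow_eq_span, ← hgr, ← range_monomialMap]
  refine stepsLinear_of_connected g (fun a => (hmem a).degree_eq) fun m a b ha hb => ?_
  have h := edgeConnected_of_gapFree hsymm hE k m _ _ (hmem a) (hmem b) ha hb
  generalize hw : g b = w at h
  clear hb
  induction h generalizing b with
  | refl => rw [hginj hw]
  | tail _ hs ih =>
    obtain ⟨c, hc⟩ := hgr.superset hs.1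
    obtain ⟨_, _, p, q, hpq, hle⟩ := hs
    exact (ih c hc).tail ⟨p, q, by rw [hc, hw, hpq], by rwa [hc]⟩

theorem gapFree_of_stepsLinear {K : Type} [Field K] (hsymm : ∀ i j, E i j → E j i) {k : ℕ}
    (hk : 1 ≤ k) (hlin : stepsLinear (edgeIdeal K E ^ k) (2 * k) 1) : GapFree E := by
  intro i i' j j' hi hj hij hij' hi'j hi'j'
  by_contra! hgap
  obtain ⟨N, g, hginj, hgr⟩ := exists_enumeration_edgeSum E k
  have hmem : ∀ a, EdgeSum E k (g a) := fun a => hgr.subset ⟨a, rfl⟩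
  rw [edgeIdeal_pow_eq_span, ← hgr, ← range_monomialMap] at hlin
  obtain ⟨a, ha⟩ := hgr.superset (edgeSum_nsmul hi k)
  obtain ⟨b, hb⟩ := hgr.superset (edgeSum_nsmul hj k)
  let χ : Fin N → Prop := fun a => ∀ x, 0 < g a x → x = i ∨ x = i'
  let M : Set (Fin n →₀ ℕ) := {m | ∀ x, 0 < m x → (x = i ∨ x = i') ∨ (x = j ∨ x = j')}
  have hM : IsLowerSet M := fun m m' hle hm x hx => hm x (hx.trans_le (hle x))
  have hsupp : ∀ p q x : Fin n, 0 < (k • (Finsupp.single p 1 + Finsupp.single q 1) : Fin n →₀ ℕ) x →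
      x = p ∨ x = q := by
    intro p q x hx
    by_contra! h
    simp [h.1.symm, h.2.symm] at hx
  refine absurd (hlin.closed_of_closed_linear hginj (fun a => (hmem a).degree_eq) χ M hM ?_
    (g a + g b) ?_ a b le_self_add le_add_self ?_ j ?_) ?_
  · intro m hm hdeg a b ha hb hχ x hx
    by_contra hxi
    have hxj : x = j ∨ x = j' := (hm x (hx.trans_le (hb x))).resolve_left hxi
    obtain ⟨_, y, w, -, hxy, -, hw⟩ := (hmem b).exists_of_pos hsymm hx
    have hy : 0 < g b y := by simp [hw]
    have hyi : ¬ (y = i ∨ y = i') := fun hyi => by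
      have := hgap y x (hsymm _ _ hxy) hyi
      tauto
    have hle : g a + (Finsupp.single x 1 + Finsupp.single y 1) ≤ m := by
      intro t
      have hat := ha t
      have hbt := hb t
      by_cases ht : 0 < g a t
      · have hti := hχ t ht
        have hxt : x ≠ t := fun h => hxi (h ▸ hti)
        have hyt : y ≠ t := fun h => hyi (h ▸ hti)
        simpa [Finsupp.single_apply, hxt, hyt] using hat
      · have hw' : g b t = (w + (Finsupp.single x 1 + Finsupp.single y 1) : Fin n →₀ ℕ) t := by
          rw [← hw]
        rw [Finsupp.add_apply] at hw' ⊢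
        omega
    have h := Finsupp.degree_mono hle
    simp only [map_add, Finsupp.degree_single, (hmem a).degree_eq] at h
    omega
  · intro x hx
    rw [ha, hb, Finsupp.add_apply] at hx
    rcases Nat.eq_zero_or_pos ((k • (Finsupp.single i 1 + Finsupp.single i' 1) : Fin n →₀ ℕ) x)
      with h | h
    · exact Or.inr (hsupp j j' x (by omega))
    · exact Or.inl (hsupp i i' x h)
  · intro x hx
    rw [ha] at hx
    exact hsupp i i' x hx
  · rw [hb]
    simp
    omega
  · rintro (h | h)
    · exact hij h.symm
    · exact hi'j h.symm

end EdgeIdeal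

/-- **Theorem.** For a finite graph `G` (possibly with loops) with edge ideal `I`,
the following are equivalent: (a) `G` is gap free; (b) `index(I^k) > 1` for all `k ≥ 1`;
(c) `index(I^k) > 1` for some `k ≥ 1`. -/
theorem stmt4 (K : Type) [Field K] (n : ℕ) (E : Fin n → Fin n → Prop)
    (hsymm : ∀ i j, E i j → E j i) :
    (GapFree E ↔ ∀ k : ℕ, 1 ≤ k → 1 < idealIndex ((edgeIdeal K E) ^ k) (2*k)) ∧
    (GapFree E ↔ ∃ k : ℕ, 1 ≤ k ∧ 1 < idealIndex ((edgeIdeal K E) ^ k) (2*k)) := by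
  simp only [one_lt_idealIndex_iff]
  refine ⟨⟨fun h k _ => stepsLinear_edgeIdeal_pow K hsymm h k,
      fun h => gapFree_of_stepsLinear hsymm le_rfl (h 1 le_rfl)⟩,
    ⟨fun h => ⟨1, le_rfl, stepsLinear_edgeIdeal_pow K hsymm h 1⟩, ?_⟩⟩
  rintro ⟨k, hk, h⟩
  exact gapFree_of_stepsLinear hsymm hk h

end
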